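/- arXiv:cs/0408039 — 7 statements merged into one kernel-verified Lean document; each statement's English description precedes it below -/
import Mathlib

section
/- Let a q-digest with total count n and compression parameter k satisfy digest property (1): every non-leaf node v in its support Q has count(v) ≤ ⌊n/k⌋. Then for every node v of T, the sum of count over the proper ancestors of v is at most log₂(σ)·⌊n/k⌋, and hence at most (log₂(σ)/k)·n. -/
open scoped Classical

namespace QDigest

/-- The node set of the complete binary tree `T` over the value range `[1, σ]`,
heap-indexed by `1, …, 2σ − 1`. -/
def nodes (σ : ℕ) : Finset ℕ := Finset.Icc 1 (2 * σ - 1)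

/-- Total count `n` of a q-digest `count`. -/
def total (σ : ℕ) (count : ℕ → ℕ) : ℕ := ∑ v ∈ nodes σ, count v

/-- Parent of a non-root node `v`. -/
def parent (v : ℕ) : ℕ := v / 2

/-- Sibling of a non-root node `v` (the other child of its parent);
maps the root `1` to the non-node `0`. -/
def sibling (v : ℕ) : ℕ := if v % 2 = 0 then v + 1 else v - 1

/-- Support (node set `Q`) of a q-digest. -/
def support (σ : ℕ) (count : ℕ → ℕ) : Finset ℕ :=
  (nodes σ).filter fun v => count v ≠ 0

/-- `u` is an ancestor of, or equal to, `v` in the heap-indexed tree. -/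
def AncOrEq (u v : ℕ) : Prop := ∃ i : ℕ, v / 2 ^ i = u

/-- The leaf corresponding to the value `x ∈ [1, σ]`. -/
def leafOf (σ x : ℕ) : ℕ := σ - 1 + x

/-- Sum of the counts over the proper ancestors of `v`. -/
def ancSum (count : ℕ → ℕ) (v : ℕ) : ℕ :=
  ∑ j ∈ Finset.Icc 1 (Nat.log 2 v), count (v / 2 ^ j)

/-- Width of the dyadic interval `range(v)` of node `v`. -/
def width (σ v : ℕ) : ℕ := σ / 2 ^ Nat.log 2 v

/-- Right endpoint `v.max` of the dyadic interval of node `v`. -/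
def vmax (σ v : ℕ) : ℕ := (v + 1) * width σ v - σ

/-- Left endpoint `v.min` of the dyadic interval of node `v`. -/
def vmin (σ v : ℕ) : ℕ := v * width σ v - σ + 1

/-- The q-digest `count` summarizes the multiset `S` of values from `[1, σ]`:
there is an assignment sending each element `x` of `S` to a node of `T` that is
an ancestor of (or equal to) the leaf corresponding to `x`, such that `count v`
is the number of elements assigned to `v`. -/
def Summarizes (σ : ℕ) (count : ℕ → ℕ) (S : Multiset ℕ) : Prop :=
  ∃ P : Multiset (ℕ × ℕ),
    P.map Prod.fst = S ∧
    (∀ p ∈ P, p.2 ∈ nodes σ ∧ AncOrEq p.2 (leafOf σ p.1)) ∧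
    ∀ v : ℕ, count v = Multiset.card (P.filter fun p => p.2 = v)

/-- `true(v)`: the number of elements of `S` lying in `range(v)`. -/
noncomputable def trueCount (σ : ℕ) (S : Multiset ℕ) (v : ℕ) : ℕ :=
  Multiset.card (S.filter fun x => AncOrEq v (leafOf σ x))

/-- `sub(v)`: sum of the counts over the subtree of `T` rooted at `v`. -/
noncomputable def subSum (σ : ℕ) (count : ℕ → ℕ) (v : ℕ) : ℕ :=
  ∑ u ∈ (nodes σ).filter (fun u => AncOrEq v u), count u

/-- `u` precedes `v`, or equals it, in the post-order of `T`: increasing right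
endpoint `v.max`, ties broken by placing smaller intervals first. -/
def postLE (σ u v : ℕ) : Prop :=
  vmax σ u < vmax σ v ∨ (vmax σ u = vmax σ v ∧ width σ u ≤ width σ v)

/-- One step of COMPRESS at the sibling pair whose parent is `u`: if digest
property (2) fails for the pair, its counts are added to the parent and zeroed. -/
def compressStep (nk : ℕ) (count : ℕ → ℕ) (u : ℕ) : ℕ → ℕ :=
  if count (2 * u) + count (2 * u + 1) + count u ≤ nk then
    fun w =>
      if w = u then count u + count (2 * u) + count (2 * u + 1)
      else if w = 2 * u ∨ w = 2 * u + 1 then 0 else count w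
  else count

/-- COMPRESS(Q, n, k): process sibling pairs level by level from the leaves
upward, i.e. parents `σ - 1, σ - 2, …, 1`. -/
def compress (σ n k : ℕ) (count : ℕ → ℕ) : ℕ → ℕ :=
  (((List.range (σ - 1)).reverse).map (· + 1)).foldl
    (fun c u => compressStep (n / k) c u) count

/-- Post-order traversal of the subtree rooted at `v` (with recursion fuel). -/
def postorderAux (σ : ℕ) : ℕ → ℕ → List ℕ
  | 0, v => [v]
  | fuel + 1, v =>
      if σ ≤ v then [v]
      else postorderAux σ fuel (2 * v) ++ postorderAux σ fuel (2 * v + 1) ++ [v]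

/-- Post-order traversal of the complete binary tree over `[1, σ]`, `σ = 2 ^ h`. -/
def postorder (σ h : ℕ) : List ℕ := postorderAux σ h 1

end QDigest

open QDigest

/-- if a q-digest (total count `n`, compression parameter `k`)
satisfies digest property (1) — every non-leaf node of its support has count at
most `⌊n/k⌋` — then for every node `v` of `T`, the sum of the counts over the
proper ancestors of `v` is at most `log₂(σ) · ⌊n/k⌋`, and hence at most
`(log₂(σ)/k) · n`. -/
theorem qdigest_ancestor_bound
    (h σ : ℕ) (hh : 1 ≤ h) (hσ : σ = 2 ^ h)
    (count : ℕ → ℕ) (hsupp : ∀ v, count v ≠ 0 → v ∈ nodes σ)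
    (n k : ℕ) (hn : total σ count = n) (hk : 1 ≤ k)
    (hprop1 : ∀ v ∈ support σ count, v < σ → count v ≤ n / k) :
    ∀ v ∈ nodes σ,
      ancSum count v ≤ Nat.log 2 σ * (n / k) ∧
      (ancSum count v : ℝ) ≤ ((Nat.log 2 σ : ℝ) / (k : ℝ)) * (n : ℝ) := by
  intro v hv
  have hlog : Nat.log 2 σ = h := by rw [hσ, Nat.log_pow (by norm_num)]
  have hv' : 1 ≤ v ∧ v ≤ 2 * σ - 1 := by simpa [nodes] using hv
  have hσpos : 0 < σ := hσ ▸ Nat.two_pow_pos h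
  have hdepth : Nat.log 2 v ≤ h := by
    refine Nat.lt_succ_iff.mp (Nat.log_lt_of_lt_pow (by omega) ?_)
    rw [pow_succ, ← hσ]
    omega
  have hanc : ∀ j ∈ Finset.Icc 1 (Nat.log 2 v), count (v / 2 ^ j) ≤ n / k := by
    intro j hj
    have hj1 : 1 ≤ j := (Finset.mem_Icc.mp hj).1
    by_cases hc : count (v / 2 ^ j) = 0
    · simp [hc]
    · have hlt : v / 2 ^ j < σ := by
        have hle : v / 2 ^ j ≤ v / 2 ^ 1 :=
          Nat.div_le_div_left (Nat.pow_le_pow_right (by norm_num) hj1) (by norm_num)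
        omega
      exact hprop1 _ (Finset.mem_filter.mpr ⟨hsupp _ hc, hc⟩) hlt
  have hbound : ancSum count v ≤ Nat.log 2 σ * (n / k) := by
    calc ancSum count v ≤ (Finset.Icc 1 (Nat.log 2 v)).card • (n / k) :=
          Finset.sum_le_card_nsmul _ _ _ hanc
      _ = Nat.log 2 v * (n / k) := by simp
      _ ≤ Nat.log 2 σ * (n / k) := Nat.mul_le_mul_right _ (hlog ▸ hdepth)
  refine ⟨hbound, ?_⟩
  calc (ancSum count v : ℝ) ≤ (Nat.log 2 σ : ℝ) * ((n / k : ℕ) : ℝ) := by exact_mod_cast hbound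
    _ ≤ (Nat.log 2 σ : ℝ) * ((n : ℝ) / k) := by
        gcongr
        exact Nat.cast_div_le
    _ = (Nat.log 2 σ : ℝ) / k * n := by ring
end

section
/- Suppose a q-digest with total count n and compression parameter k satisfies digest property (1) (every non-leaf node v in its support Q has count(v) ≤ ⌊n/k⌋) and summarizes a multiset S of n values from [1,σ]. For a node v of T let true(v) denote the number of elements of S lying in range(v) and let sub(v) denote the sum of count(u) over all nodes u in the subtree of T rooted at v. Then for every node v, 0 ≤ true(v) − sub(v) ≤ (log₂(σ)/k)·n; that is, the maximum error in the count of any node is at most (log₂(σ)/k)·n. -/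
open scoped Classical

open QDigest

namespace QDigest

theorem AncOrEq.trans {u v w : ℕ} (huv : AncOrEq u v) (hvw : AncOrEq v w) : AncOrEq u w := by
  obtain ⟨i, rfl⟩ := huv
  obtain ⟨j, rfl⟩ := hvw
  exact ⟨j + i, by rw [pow_add, Nat.div_div_eq_div_mul]⟩

/-- Two ancestors of a common node are comparable. -/
theorem AncOrEq.ancOrEq_or_eq_div {u v w : ℕ} (hu : AncOrEq u w) (hv : AncOrEq v w) :
    AncOrEq v u ∨ ∃ j, 1 ≤ j ∧ u = v / 2 ^ j := by
  obtain ⟨i, rfl⟩ := hu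
  obtain ⟨j, rfl⟩ := hv
  rcases le_or_gt i j with hij | hij
  · exact Or.inl ⟨j - i, by rw [Nat.div_div_eq_div_mul, ← pow_add, Nat.add_sub_cancel' hij]⟩
  · exact Or.inr ⟨i - j, by omega,
      by rw [Nat.div_div_eq_div_mul, ← pow_add, Nat.add_sub_cancel' hij.le]⟩

theorem card_filter_mem_eq_sum {α β : Type*} [DecidableEq β] (P : Multiset α) (f : α → β)
    (s : Finset β) :
    Multiset.card (P.filter fun p => f p ∈ s)
      = ∑ u ∈ s, Multiset.card (P.filter fun p => f p = u) := by
  induction P using Multiset.induction_on with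
  | empty => simp
  | cons a P ih =>
    simp only [← Multiset.countP_eq_card_filter, Multiset.countP_cons] at ih ⊢
    rw [Finset.sum_add_distrib, ih]
    simp

theorem filter_le_filter_of_imp {α : Type*} {P : Multiset α} {p q : α → Prop}
    [DecidablePred p] [DecidablePred q] (hpq : ∀ a ∈ P, p a → q a) : P.filter p ≤ P.filter q :=
  Multiset.le_filter.mpr ⟨Multiset.filter_le _ _, fun a ha =>
    hpq a (Multiset.mem_of_mem_filter ha) (Multiset.of_mem_filter ha)⟩

/-- The proper ancestors of `v` in the heap-indexed tree. -/
noncomputable def properAncestors (v : ℕ) : Finset ℕ :=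
  (Finset.Icc 1 (Nat.log 2 v)).image fun j => v / 2 ^ j

theorem card_properAncestors_le (v : ℕ) : (properAncestors v).card ≤ Nat.log 2 v :=
  Finset.card_image_le.trans (by simp)

theorem div_mem_properAncestors {v j : ℕ} (hj : 1 ≤ j) (hpos : 1 ≤ v / 2 ^ j) :
    v / 2 ^ j ∈ properAncestors v := by
  have hle : 2 ^ j ≤ v := (Nat.div_pos_iff.mp hpos).2
  exact Finset.mem_image_of_mem _
    (Finset.mem_Icc.mpr ⟨hj, Nat.le_log_of_pow_le one_lt_two hle⟩)

theorem lt_of_mem_properAncestors {σ u v : ℕ} (hv : v ∈ nodes σ) (hu : u ∈ properAncestors v) :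
    u < σ := by
  obtain ⟨j, hj, rfl⟩ := Finset.mem_image.mp hu
  obtain ⟨hj1, -⟩ := Finset.mem_Icc.mp hj
  obtain ⟨hv1, hv2⟩ := Finset.mem_Icc.mp hv
  have hpow : 2 ^ 1 ≤ 2 ^ j := Nat.pow_le_pow_right two_pos hj1
  have hdiv : v / 2 ^ j ≤ v / 2 ^ 1 := Nat.div_le_div_left hpow (by norm_num)
  omega

theorem log_le_of_mem_nodes {h v : ℕ} (hv : v ∈ nodes (2 ^ h)) : Nat.log 2 v ≤ h := by
  obtain ⟨hv1, hv2⟩ := Finset.mem_Icc.mp hv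
  have hlt : v < 2 ^ (h + 1) := by rw [pow_succ]; omega
  exact Nat.lt_succ_iff.mp (Nat.log_lt_of_lt_pow (by omega) hlt)

theorem Summarizes.subSum_le_trueCount {σ : ℕ} {count : ℕ → ℕ} {S : Multiset ℕ}
    (hsum : Summarizes σ count S) (v : ℕ) : subSum σ count v ≤ trueCount σ S v := by
  obtain ⟨P, rfl, hP, hcount⟩ := hsum
  simp only [subSum, hcount, trueCount, Multiset.filter_map, Multiset.card_map]
  rw [← card_filter_mem_eq_sum P Prod.snd]
  refine Multiset.card_le_card (filter_le_filter_of_imp ?_)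
  intro p hp hmem
  exact (Finset.mem_filter.mp hmem).2.trans (hP p hp).2

theorem Summarizes.trueCount_le {σ : ℕ} {count : ℕ → ℕ} {S : Multiset ℕ}
    (hsum : Summarizes σ count S) (v : ℕ) :
    trueCount σ S v ≤ subSum σ count v + ∑ u ∈ properAncestors v, count u := by
  obtain ⟨P, rfl, hP, hcount⟩ := hsum
  simp only [subSum, hcount, trueCount, Multiset.filter_map, Multiset.card_map]
  rw [← card_filter_mem_eq_sum P Prod.snd, ← card_filter_mem_eq_sum P Prod.snd, ← Multiset.card_add,
    Multiset.filter_add_filter, Multiset.card_add]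
  refine le_trans (Multiset.card_le_card (filter_le_filter_of_imp ?_))
    (Nat.le_add_right _ _)
  intro p hp hv
  obtain ⟨hnode, hanc⟩ := hP p hp
  rcases hanc.ancOrEq_or_eq_div hv with hsub | ⟨j, hj, hu⟩
  · exact Or.inl (Finset.mem_filter.mpr ⟨hnode, hsub⟩)
  · refine Or.inr ?_
    have hpos : 1 ≤ p.2 := (Finset.mem_Icc.mp hnode).1
    rw [hu] at hpos ⊢
    exact div_mem_properAncestors hj hpos

end QDigest

/-- if a q-digest (total count `n`, compression parameter `k`)
satisfies digest property (1) and summarizes a multiset `S` of `n` values from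
`[1, σ]`, then for every node `v` of `T`,
`0 ≤ true(v) − sub(v) ≤ (log₂(σ)/k) · n`, where `true(v)` is the number of
elements of `S` in `range(v)` and `sub(v)` is the sum of the counts over the
subtree rooted at `v`. -/
theorem qdigest_count_error_bound
    (h σ : ℕ) (hh : 1 ≤ h) (hσ : σ = 2 ^ h)
    (count : ℕ → ℕ) (hsupp : ∀ v, count v ≠ 0 → v ∈ nodes σ)
    (S : Multiset ℕ) (hS : ∀ x ∈ S, x ∈ Finset.Icc 1 σ)
    (n k : ℕ) (hcard : Multiset.card S = n) (hn : total σ count = n) (hk : 1 ≤ k)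
    (hsum : Summarizes σ count S)
    (hprop1 : ∀ v ∈ support σ count, v < σ → count v ≤ n / k) :
    ∀ v ∈ nodes σ,
      subSum σ count v ≤ trueCount σ S v ∧
      (trueCount σ S v : ℝ) - (subSum σ count v : ℝ)
        ≤ ((Nat.log 2 σ : ℝ) / (k : ℝ)) * (n : ℝ) := by
  intro v hv
  refine ⟨hsum.subSum_le_trueCount v, ?_⟩
  have hcount : ∀ u ∈ properAncestors v, count u ≤ n / k := by
    intro u hu
    by_cases hzero : count u = 0
    · simp [hzero]
    · exact hprop1 u (Finset.mem_filter.mpr ⟨hsupp u hzero, hzero⟩)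
        (lt_of_mem_properAncestors hv hu)
  subst hσ
  have hbound : trueCount (2 ^ h) S v ≤ subSum (2 ^ h) count v + h * (n / k) := by
    refine (hsum.trueCount_le v).trans (Nat.add_le_add_left ?_ _)
    refine (Finset.sum_le_card_nsmul _ _ _ hcount).trans ?_
    exact Nat.mul_le_mul_right _ ((card_properAncestors_le v).trans (log_le_of_mem_nodes hv))
  have hreal : (trueCount (2 ^ h) S v : ℝ)
      ≤ subSum (2 ^ h) count v + h * ((n / k : ℕ) : ℝ) := by exact_mod_cast hbound
  have hdiv : (h : ℝ) * ((n / k : ℕ) : ℝ) ≤ h * ((n : ℝ) / k) :=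
    mul_le_mul_of_nonneg_left Nat.cast_div_le (Nat.cast_nonneg h)
  rw [Nat.log_pow one_lt_two, div_mul_eq_mul_div, mul_div_assoc]
  linarith
end

section
/- For every multiset S of n ≥ 1 values from [1,σ] and every positive integer k, there exists a q-digest with compression parameter k that summarizes S, satisfies the digest property (properties (1) and (2)), and whose support has at most 3k nodes. -/
open scoped Classical

namespace QDigest

/-- Number of elements of `S` that the assignment `f` sends to the node `v`. -/
def assignedCount (S : Multiset ℕ) (f : ℕ → ℕ) (v : ℕ) : ℕ := (S.map f).count v

lemma assignedCount_ne_zero {S : Multiset ℕ} {f : ℕ → ℕ} {v : ℕ}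
    (hv : assignedCount S f v ≠ 0) : ∃ x ∈ S, f x = v := by
  simpa [assignedCount, Multiset.count_eq_zero] using hv

lemma assignedCount_congr {S : Multiset ℕ} {f g : ℕ → ℕ} {v : ℕ}
    (hfg : ∀ x ∈ S, f x = v ↔ g x = v) : assignedCount S f v = assignedCount S g v := by
  simp only [assignedCount, Multiset.count_map]
  congr 1
  exact Multiset.filter_congr fun x hx => by simpa [eq_comm] using hfg x hx

/-- Move everything assigned to a child of `u` to `u` itself. -/
def mergeAt (u : ℕ) (f : ℕ → ℕ) (x : ℕ) : ℕ := if f x / 2 = u then u else f x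

lemma assignedCount_mergeAt_self {S : Multiset ℕ} {f : ℕ → ℕ} {u : ℕ}
    (hu : ∀ x ∈ S, f x ≠ u) :
    assignedCount S (mergeAt u f) u =
      assignedCount S f (2 * u) + assignedCount S f (2 * u + 1) := by
  induction S using Multiset.induction_on with
  | empty => simp [assignedCount]
  | cons a S ih =>
    have ih' := ih fun x hx => hu x (Multiset.mem_cons_of_mem hx)
    have ha := hu a (Multiset.mem_cons_self a S)
    simp only [assignedCount, Multiset.map_cons, Multiset.count_cons] at ih' ⊢
    rw [ih']
    simp only [mergeAt]
    split_ifs <;> omega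

/-- Processing the sibling pairs below the parents `σ - 1, …, t` bottom-up gives an
assignment in which every processed pair is empty or exceeds the threshold `m`. -/
lemma exists_assignment_above (σ m : ℕ) (S : Multiset ℕ) (hS : ∀ x ∈ S, x ∈ Finset.Icc 1 σ)
    {t : ℕ} (ht : 1 ≤ t) (htσ : t ≤ σ) :
    ∃ f : ℕ → ℕ,
      (∀ x ∈ S, t ≤ f x ∧ f x ≤ 2 * σ - 1 ∧ AncOrEq (f x) (leafOf σ x)) ∧
      (∀ v < σ, assignedCount S f v ≤ m) ∧
      ∀ u, t ≤ u → u < σ →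
        (assignedCount S f (2 * u) = 0 ∧ assignedCount S f (2 * u + 1) = 0) ∨
          m < assignedCount S f (2 * u) + assignedCount S f (2 * u + 1) := by
  induction htσ using Nat.decreasingInduction with
  | self =>
    have hleaf : ∀ x ∈ S, σ ≤ leafOf σ x ∧ leafOf σ x ≤ 2 * σ - 1 := fun x hx => by
      have := Finset.mem_Icc.1 (hS x hx)
      simp only [leafOf]
      omega
    refine ⟨leafOf σ, fun x hx => ⟨(hleaf x hx).1, (hleaf x hx).2, 0, by simp⟩,
      fun v hv => ?_, fun u h₁ h₂ => by omega⟩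
    by_contra hne
    obtain ⟨x, hx, rfl⟩ := assignedCount_ne_zero (S := S) (f := leafOf σ) (v := v) (by omega)
    have := hleaf x hx
    omega
  | of_succ u huσ ih =>
    obtain ⟨f, hf, hle, hpair⟩ := ih (by omega)
    by_cases hm : assignedCount S f (2 * u) + assignedCount S f (2 * u + 1) ≤ m
    · have hself := assignedCount_mergeAt_self (S := S) (f := f) (u := u)
        fun x hx => by have := (hf x hx).1; omega
      have hchild : ∀ v, v / 2 = u → assignedCount S (mergeAt u f) v = 0 := fun v hv => by
        by_contra hne
        obtain ⟨x, -, hxv⟩ := assignedCount_ne_zero hne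
        simp only [mergeAt] at hxv
        split_ifs at hxv <;> grind
      have hother : ∀ v, v ≠ u → v / 2 ≠ u →
          assignedCount S (mergeAt u f) v = assignedCount S f v := fun v h₁ h₂ =>
        assignedCount_congr fun x _ => by
          simp only [mergeAt]
          split_ifs <;> grind
      refine ⟨mergeAt u f, fun x hx => ?_, fun v hv => ?_, fun w hw hwσ => ?_⟩
      · obtain ⟨h₁, h₂, i, hi⟩ := hf x hx
        simp only [mergeAt]
        split_ifs with hxu
        · refine ⟨le_rfl, by omega, i + 1, ?_⟩
          rw [pow_succ, ← Nat.div_div_eq_div_mul, hi, hxu]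
        · exact ⟨by omega, h₂, i, hi⟩
      · by_cases hvu : v = u
        · rw [hvu, hself]
          exact hm
        · by_cases hv2 : v / 2 = u
          · rw [hchild v hv2]
            exact Nat.zero_le m
          · rw [hother v hvu hv2]
            exact hle v hv
      · by_cases hwu : w = u
        · exact Or.inl ⟨hchild _ (by omega), hchild _ (by omega)⟩
        · rw [hother (2 * w) (by omega) (by omega), hother (2 * w + 1) (by omega) (by omega)]
          exact hpair w (by omega) hwσ
    · refine ⟨f, fun x hx => ⟨by have := (hf x hx).1; omega, (hf x hx).2⟩, hle,
        fun w hw hwσ => ?_⟩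
      by_cases hwu : w = u
      · subst hwu
        exact Or.inr (by omega)
      · exact hpair w (by omega) hwσ

lemma sibling_mem_nodes {σ v : ℕ} (hv : v ∈ nodes σ) (hv1 : v ≠ 1) : sibling v ∈ nodes σ := by
  simp only [nodes, sibling, Finset.mem_Icc] at *
  split_ifs <;> omega

/-- If every non-root support node and its sibling together exceed `m`, then counting every
node at most twice bounds the size of the support. -/
lemma card_support_mul_le {σ m : ℕ} {count : ℕ → ℕ}
    (hpair : ∀ v ∈ support σ count, v ≠ 1 → m < count v + count (sibling v)) :
    ((support σ count).erase 1).card * (m + 1) ≤ 2 * total σ count := by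
  set Q := (support σ count).erase 1 with hQ
  have hmem : ∀ v ∈ Q, v ∈ nodes σ ∧ v ≠ 1 ∧ v ∈ support σ count := fun v hv => by
    have h := Finset.mem_erase.1 hv
    exact ⟨(Finset.mem_filter.1 h.2).1, h.1, h.2⟩
  have hinj : Set.InjOn sibling Q := fun a ha b hb hab => by
    have h₁ := hmem a ha
    have h₂ := hmem b hb
    simp only [nodes, Finset.mem_Icc] at h₁ h₂
    simp only [sibling] at hab
    split_ifs at hab <;> omega
  have hown : ∑ v ∈ Q, count v ≤ total σ count :=
    Finset.sum_le_sum_of_subset fun v hv => (hmem v hv).1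
  have hsib : ∑ v ∈ Q, count (sibling v) ≤ total σ count := by
    rw [← Finset.sum_image (f := count) hinj]
    refine Finset.sum_le_sum_of_subset fun w hw => ?_
    obtain ⟨v, hv, rfl⟩ := Finset.mem_image.1 hw
    exact sibling_mem_nodes (hmem v hv).1 (hmem v hv).2.1
  calc Q.card * (m + 1) ≤ ∑ v ∈ Q, (count v + count (sibling v)) := by
        rw [← smul_eq_mul]
        exact Finset.card_nsmul_le_sum _ _ _ fun v hv => hpair v (hmem v hv).2.2 (hmem v hv).2.1
    _ ≤ 2 * total σ count := by
        rw [Finset.sum_add_distrib]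
        omega

lemma summarizes_assignedCount {σ : ℕ} {S : Multiset ℕ} {f : ℕ → ℕ}
    (hf : ∀ x ∈ S, f x ∈ nodes σ ∧ AncOrEq (f x) (leafOf σ x)) :
    Summarizes σ (assignedCount S f) S := by
  refine ⟨S.map fun x => (x, f x), by simp, fun p hp => ?_, fun v => ?_⟩
  · obtain ⟨x, hx, rfl⟩ := Multiset.mem_map.1 hp
    exact hf x hx
  · simp [assignedCount, Multiset.count_map, Multiset.filter_map, eq_comm]

end QDigest

open QDigest

/-- for every multiset `S` of `n ≥ 1` values from `[1, σ]` and
every positive integer `k` there exists a q-digest with compression parameter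
`k` that summarizes `S`, satisfies digest properties (1) and (2), and whose
support has at most `3k` nodes. -/
theorem qdigest_exists
    (h σ : ℕ) (hh : 1 ≤ h) (hσ : σ = 2 ^ h)
    (k : ℕ) (hk : 1 ≤ k)
    (n : ℕ) (hn : 1 ≤ n)
    (S : Multiset ℕ) (hcard : Multiset.card S = n)
    (hS : ∀ x ∈ S, x ∈ Finset.Icc 1 σ) :
    ∃ count : ℕ → ℕ,
      (∀ v, count v ≠ 0 → v ∈ nodes σ) ∧
      Summarizes σ count S ∧
      total σ count = n ∧
      (∀ v ∈ support σ count, v < σ → count v ≤ n / k) ∧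
      (∀ v ∈ support σ count, v ≠ 1 →
        n / k < count v + count (parent v) + count (sibling v)) ∧
      (support σ count).card ≤ 3 * k := by
  have hσ1 : 1 ≤ σ := hσ ▸ Nat.one_le_two_pow
  obtain ⟨f, hf, hle, hpair⟩ := exists_assignment_above σ (n / k) S hS le_rfl hσ1
  have hnode : ∀ x ∈ S, f x ∈ nodes σ := fun x hx =>
    Finset.mem_Icc.2 ⟨(hf x hx).1, (hf x hx).2.1⟩
  have htotal : total σ (assignedCount S f) = n := by
    rw [← hcard, ← Multiset.card_map f S]
    refine Multiset.sum_count_eq_card fun v hv => ?_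
    obtain ⟨x, hx, rfl⟩ := Multiset.mem_map.1 hv
    exact hnode x hx
  have hsib : ∀ v ∈ support σ (assignedCount S f), v ≠ 1 →
      n / k < assignedCount S f v + assignedCount S f (sibling v) := fun v hv hv1 => by
    obtain ⟨hv, hv0⟩ := Finset.mem_filter.1 hv
    have hv := Finset.mem_Icc.1 hv
    have hp := hpair (v / 2) (by omega) (by omega)
    simp only [sibling]
    split_ifs with hpar
    · rw [show 2 * (v / 2) = v by omega] at hp
      omega
    · rw [show 2 * (v / 2) + 1 = v by omega, show 2 * (v / 2) = v - 1 by omega] at hp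
      omega
  refine ⟨assignedCount S f, fun v hv => ?_,
    summarizes_assignedCount fun x hx => ⟨hnode x hx, (hf x hx).2.2⟩, htotal,
    fun v _ hv => hle v hv, fun v hv hv1 => ?_, ?_⟩
  · obtain ⟨x, hx, rfl⟩ := assignedCount_ne_zero hv
    exact hnode x hx
  · have := hsib v hv hv1
    omega
  · have hmul := card_support_mul_le hsib
    rw [htotal] at hmul
    have hlt : n < k * (n / k + 1) := Nat.lt_mul_div_succ n hk
    have hQ : ((support σ (assignedCount S f)).erase 1).card < 2 * k := by
      refine Nat.lt_of_mul_lt_mul_right (a := n / k + 1) (hmul.trans_lt ?_)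
      rw [mul_assoc]
      omega
    have := Finset.pred_card_le_card_erase (s := support σ (assignedCount S f)) (a := 1)
    omega
end

section
/- Suppose a q-digest summarizes a multiset S of n values from [1,σ]. Then for every node v in its support Q: (a) the sum of count(w) over all nodes w of Q that precede v or equal v in the post-order list L is at most the number of elements of S that are ≤ v.max; and (b) the number of elements of S that are ≤ v.max exceeds this sum by at most the sum of count over the proper ancestors of v. -/
open scoped Classical

open QDigest

namespace QDigest

/-- In a multiset of pairs, the pairs whose second component lies in `F` are counted by fibers. -/
theorem card_filter_snd_mem (P : Multiset (ℕ × ℕ)) (F : Finset ℕ) :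
    Multiset.card (P.filter fun p => p.2 ∈ F)
      = ∑ w ∈ F, Multiset.card (P.filter fun p => p.2 = w) := by
  induction P using Multiset.induction_on with
  | empty => simp
  | cons a P ih =>
    simp only [← Multiset.countP_eq_card_filter, Multiset.countP_cons,
      Finset.sum_add_distrib] at ih ⊢
    rw [ih, Finset.sum_ite_eq]

theorem card_filter_le_add {α : Type*} (P : Multiset α) (p q r : α → Prop)
    [DecidablePred p] [DecidablePred q] [DecidablePred r]
    (hpqr : ∀ a ∈ P, p a → q a ∨ r a) :
    Multiset.card (P.filter p) ≤ Multiset.card (P.filter q) + Multiset.card (P.filter r) := by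
  rw [← Multiset.card_add, Multiset.filter_add_filter, Multiset.card_add]
  refine le_trans (Multiset.card_le_card ?_) (Nat.le_add_right _ _)
  rw [← Multiset.filter_congr (p := fun a => p a ∧ (q a ∨ r a))
    fun a ha => ⟨And.left, fun hp => ⟨hp, hpqr a ha hp⟩⟩]
  exact Multiset.monotone_filter_right P fun a ha => ha.2

/-- A node at depth `d ≤ h` has width `2 ^ (h - d)`, and this width determines `v.max`. -/
theorem exists_width_eq {h v : ℕ} (hv : v ∈ nodes (2 ^ h)) :
    ∃ i, i + Nat.log 2 v = h ∧ width (2 ^ h) v = 2 ^ i ∧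
      vmax (2 ^ h) v + 2 ^ h = (v + 1) * 2 ^ i := by
  obtain ⟨h1, h2⟩ := Finset.mem_Icc.mp hv
  have hlt : v < 2 ^ (h + 1) := by have := Nat.two_pow_pos h; rw [pow_succ]; omega
  have hlog : Nat.log 2 v ≤ h := Nat.lt_succ_iff.mp (Nat.log_lt_of_lt_pow (by omega) hlt)
  have hw : width (2 ^ h) v = 2 ^ (h - Nat.log 2 v) := Nat.pow_div hlog two_pos
  refine ⟨h - Nat.log 2 v, Nat.sub_add_cancel hlog, hw, ?_⟩
  rw [vmax, hw]
  apply Nat.sub_add_cancel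
  calc 2 ^ h = 2 ^ Nat.log 2 v * 2 ^ (h - Nat.log 2 v) := by
        rw [← pow_add, Nat.add_sub_cancel' hlog]
    _ ≤ (v + 1) * 2 ^ (h - Nat.log 2 v) :=
        Nat.mul_le_mul_right _ ((Nat.pow_log_le_self 2 (by omega)).trans (Nat.le_succ v))

/-- The leaves below a node `w` of width `2 ^ i` are those in `[w * 2 ^ i, (w + 1) * 2 ^ i)`. -/
theorem leafOf_mem_of_ancOrEq {h w x i : ℕ} (hw : w ∈ nodes (2 ^ h))
    (hx : x ∈ Finset.Icc 1 (2 ^ h)) (hanc : AncOrEq w (leafOf (2 ^ h) x))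
    (hi : i + Nat.log 2 w = h) :
    w * 2 ^ i < x + 2 ^ h ∧ x + 2 ^ h ≤ (w + 1) * 2 ^ i := by
  obtain ⟨h1, h2⟩ := Finset.mem_Icc.mp hx
  have hw1 := (Finset.mem_Icc.mp hw).1
  have hpos := Nat.two_pow_pos h
  obtain ⟨j, hj⟩ := hanc
  have hleaf : Nat.log 2 (leafOf (2 ^ h) x) = h := by
    apply Nat.log_eq_of_pow_le_of_lt_pow <;> unfold leafOf
    · omega
    · rw [pow_succ]; omega
  have hlogw : Nat.log 2 w = h - j := by rw [← hj, Nat.log_div_base_pow, hleaf]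
  have hjh : j ≤ h := by
    by_contra hlt
    have hz : leafOf (2 ^ h) x / 2 ^ j = 0 :=
      Nat.div_eq_of_lt (Nat.lt_pow_of_log_lt one_lt_two (by omega))
    omega
  obtain rfl : j = i := by omega
  have hle := Nat.div_mul_le_self (leafOf (2 ^ h) x) (2 ^ j)
  have hlt := Nat.lt_mul_of_div_lt (Nat.lt_succ_self (leafOf (2 ^ h) x / 2 ^ j)) (Nat.two_pow_pos j)
  rw [hj] at hle hlt
  rw [Nat.succ_eq_add_one] at hlt
  unfold leafOf at hle hlt
  omega

theorem le_vmax_of_ancOrEq {h w x : ℕ} (hw : w ∈ nodes (2 ^ h))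
    (hx : x ∈ Finset.Icc 1 (2 ^ h)) (hanc : AncOrEq w (leafOf (2 ^ h) x)) :
    x ≤ vmax (2 ^ h) w := by
  obtain ⟨i, hi, -, hmax⟩ := exists_width_eq hw
  have := (leafOf_mem_of_ancOrEq hw hx hanc hi).2
  omega

theorem vmax_le_of_postLE {σ w v : ℕ} (hwv : postLE σ w v) : vmax σ w ≤ vmax σ v :=
  hwv.elim le_of_lt fun h => h.1.le

/-- A node containing some `x ≤ v.max` either comes no later than `v` in post-order,
or is a proper ancestor of `v`. -/
theorem postLE_or_proper_ancestor {h v w x : ℕ} (hv : v ∈ nodes (2 ^ h))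
    (hw : w ∈ nodes (2 ^ h)) (hx : x ∈ Finset.Icc 1 (2 ^ h))
    (hanc : AncOrEq w (leafOf (2 ^ h) x)) (hxv : x ≤ vmax (2 ^ h) v) :
    postLE (2 ^ h) w v ∨ ∃ j ∈ Finset.Icc 1 (Nat.log 2 v), v / 2 ^ j = w := by
  obtain ⟨i, hi, hwid, hmax⟩ := exists_width_eq hw
  obtain ⟨k, hk, hvwid, hvmax⟩ := exists_width_eq hv
  have hlt : w * 2 ^ i < (v + 1) * 2 ^ k :=
    (leafOf_mem_of_ancOrEq hw hx hanc hi).1.trans_le (by omega)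
  rcases le_or_gt i k with hik | hki
  · left
    obtain ⟨m, rfl⟩ := Nat.exists_eq_add_of_le hik
    have hle : vmax (2 ^ h) w ≤ vmax (2 ^ h) v := by
      rw [pow_add, mul_comm (2 ^ i), ← mul_assoc] at hlt hvmax
      have := Nat.mul_le_mul_right (2 ^ i)
        (Nat.succ_le_of_lt (Nat.lt_of_mul_lt_mul_right hlt))
      rw [Nat.succ_eq_add_one] at this
      omega
    have hwle : width (2 ^ h) w ≤ width (2 ^ h) v := by
      rw [hwid, hvwid]; exact Nat.pow_le_pow_right two_pos hik
    exact hle.lt_or_eq.imp id fun he => ⟨he, hwle⟩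
  · obtain ⟨m, rfl⟩ := Nat.exists_eq_add_of_lt hki
    by_cases hle : vmax (2 ^ h) w < vmax (2 ^ h) v
    · exact Or.inl (Or.inl hle)
    right
    refine ⟨m + 1, Finset.mem_Icc.mpr ⟨by omega, by omega⟩, ?_⟩
    have hge : (v + 1) * 2 ^ k ≤ (w + 1) * 2 ^ (k + m + 1) := by omega
    rw [add_assoc, pow_add, mul_comm (2 ^ k), ← mul_assoc] at hlt hge
    have h1 := Nat.lt_of_mul_lt_mul_right hlt
    have h2 := Nat.le_of_mul_le_mul_right hge (Nat.two_pow_pos k)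
    exact Nat.div_eq_of_lt_le (by omega) (by omega)

end QDigest

/-- if a q-digest summarizes a multiset `S` of values from
`[1, σ]`, then for every node `v` of its support `Q`: (a) the sum of the counts
over the nodes of `Q` that precede `v` or equal `v` in the post-order list `L`
is at most the number of elements of `S` that are `≤ v.max`; and (b) that
number of elements exceeds this sum by at most the sum of the counts over the
proper ancestors of `v`. -/
theorem postorder_prefix_bounds
    (h σ : ℕ) (hh : 1 ≤ h) (hσ : σ = 2 ^ h)
    (count : ℕ → ℕ) (hsupp : ∀ v, count v ≠ 0 → v ∈ nodes σ)
    (S : Multiset ℕ) (hS : ∀ x ∈ S, x ∈ Finset.Icc 1 σ)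
    (hsum : Summarizes σ count S) :
    ∀ v ∈ support σ count,
      (∑ w ∈ (support σ count).filter (fun w => postLE σ w v), count w)
          ≤ Multiset.card (S.filter fun x => x ≤ vmax σ v) ∧
      Multiset.card (S.filter fun x => x ≤ vmax σ v)
          ≤ (∑ w ∈ (support σ count).filter (fun w => postLE σ w v), count w)
            + ancSum count v := by
  subst hσ
  obtain ⟨P, rfl, hP, hcount⟩ := hsum
  intro v hv
  have hvn : v ∈ nodes (2 ^ h) := (Finset.mem_filter.mp hv).1
  have hval : ∀ p ∈ P, p.1 ∈ Finset.Icc 1 (2 ^ h) := fun p hp =>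
    hS p.1 (Multiset.mem_map_of_mem _ hp)
  have hsup : ∀ p ∈ P, p.2 ∈ support (2 ^ h) count := fun p hp => by
    refine Finset.mem_filter.mpr ⟨(hP p hp).1, ?_⟩
    rw [hcount, ← Nat.pos_iff_ne_zero, Multiset.card_pos_iff_exists_mem]
    exact ⟨p, Multiset.mem_filter.mpr ⟨hp, rfl⟩⟩
  have hprefix : ∑ w ∈ (support (2 ^ h) count).filter (fun w => postLE (2 ^ h) w v), count w
      = Multiset.card (P.filter fun p => postLE (2 ^ h) p.2 v) := by
    simp_rw [hcount]
    rw [← card_filter_snd_mem]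
    refine congrArg _ (Multiset.filter_congr fun p hp => ?_)
    simpa using fun _ => hsup p hp
  have hleft : Multiset.card ((P.map Prod.fst).filter fun x => x ≤ vmax (2 ^ h) v)
      = Multiset.card (P.filter fun p => p.1 ≤ vmax (2 ^ h) v) := by
    rw [Multiset.filter_map, Multiset.card_map]; rfl
  have hanc : Multiset.card (P.filter fun p =>
      p.2 ∈ (Finset.Icc 1 (Nat.log 2 v)).image fun j => v / 2 ^ j) ≤ ancSum count v := by
    rw [card_filter_snd_mem, ancSum]
    simp_rw [← hcount]
    exact Finset.sum_image_le_of_nonneg fun _ _ => Nat.zero_le _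
  rw [hprefix, hleft]
  constructor
  · apply Multiset.card_le_card
    refine Multiset.le_filter.mpr ⟨Multiset.filter_le _ _, fun p hp => ?_⟩
    obtain ⟨hp, hle⟩ := Multiset.mem_filter.mp hp
    exact (le_vmax_of_ancOrEq (hP p hp).1 (hval p hp) (hP p hp).2).trans (vmax_le_of_postLE hle)
  · refine le_trans ?_ (Nat.add_le_add_left hanc _)
    refine card_filter_le_add P _ _ _ fun p hp hle => ?_
    simpa only [Finset.mem_image] using
      postLE_or_proper_ancestor hvn (hP p hp).1 (hval p hp) (hP p hp).2 hle
end

section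
/- Let a q-digest with total count n and compression parameter k satisfy digest property (1) and summarize a multiset S of n values from [1,σ], and set ε = (log₂ σ)/k. Given q ∈ (0,1), let v be the first node of the post-order list L at which the running sum of counts reaches at least qn, and report the value v.max. Then the rank of the reported value in S is between qn and (q+ε)n: at least qn elements of S are ≤ v.max, and fewer than (q+ε)n + 1 elements of S are < v.max. -/
open scoped Classical

namespace QDigest

/-- The number of pairs whose second component lies in `A`, summed fibrewise. -/
lemma sum_card_filter_snd (P : Multiset (ℕ × ℕ)) (A : Finset ℕ) :
    ∑ w ∈ A, Multiset.card (P.filter fun p => p.2 = w)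
      = Multiset.card (P.filter fun p => p.2 ∈ A) := by
  induction P using Multiset.induction_on with
  | empty => simp
  | cons a P ih =>
    simp only [← Multiset.countP_eq_card_filter, Multiset.countP_cons,
      Finset.sum_add_distrib] at ih ⊢
    rw [ih, Finset.sum_ite_eq]

lemma card_filter_le_of_imp {α : Type*} {P : Multiset α} {p r : α → Prop}
    [DecidablePred p] [DecidablePred r] (hpr : ∀ a ∈ P, p a → r a) :
    Multiset.card (P.filter p) ≤ Multiset.card (P.filter r) := by
  have : P.filter p = (P.filter r).filter p := by
    rw [Multiset.filter_filter]
    exact Multiset.filter_congr fun a ha => ⟨fun hp => ⟨hp, hpr a ha hp⟩, And.left⟩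
  rw [this]
  exact Multiset.card_le_card (Multiset.filter_le _ _)

lemma card_filter_map_fst (P : Multiset (ℕ × ℕ)) (p : ℕ → Prop) [DecidablePred p] :
    Multiset.card ((P.map Prod.fst).filter p) = Multiset.card (P.filter fun a => p a.1) := by
  rw [Multiset.filter_map, Multiset.card_map]
  rfl

/-- A node lying `i` levels above the leaf of `x` has width `2 ^ i`. -/
lemma exists_width_eq_s8 {h x w : ℕ} (hx : x ∈ Finset.Icc 1 (2 ^ h)) (hw : 1 ≤ w)
    (ha : AncOrEq w (leafOf (2 ^ h) x)) :
    ∃ i ≤ h, leafOf (2 ^ h) x / 2 ^ i = w ∧ width (2 ^ h) w = 2 ^ i := by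
  obtain ⟨i, hi⟩ := ha
  rw [Finset.mem_Icc] at hx
  have hlog : Nat.log 2 (leafOf (2 ^ h) x) = h := by
    apply Nat.log_eq_of_pow_le_of_lt_pow
    · unfold leafOf; omega
    · unfold leafOf; rw [pow_succ]; omega
  have hih : i ≤ h := by
    by_contra! hlt
    have : leafOf (2 ^ h) x / 2 ^ i = 0 := by
      apply Nat.div_eq_of_lt
      calc leafOf (2 ^ h) x < 2 ^ (h + 1) := by unfold leafOf; rw [pow_succ]; omega
        _ ≤ 2 ^ i := Nat.pow_le_pow_right (by norm_num) hlt
    omega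
  refine ⟨i, hih, hi, ?_⟩
  have hlw : Nat.log 2 w = h - i := by
    rw [← hi, Nat.log_div_base_pow, hlog]
  rw [width, hlw, Nat.pow_div (Nat.sub_le h i) (by norm_num), Nat.sub_sub_self hih]

/-- Every value lies below the right endpoint of each ancestor of its leaf. -/
lemma le_vmax {h x w : ℕ} (hx : x ∈ Finset.Icc 1 (2 ^ h)) (hw : 1 ≤ w)
    (ha : AncOrEq w (leafOf (2 ^ h) x)) : x ≤ vmax (2 ^ h) w := by
  obtain ⟨i, -, hi, hwd⟩ := exists_width_eq_s8 hx hw ha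
  have hlt : leafOf (2 ^ h) x < (w + 1) * 2 ^ i := by
    rw [← hi, mul_comm]
    exact Nat.lt_mul_div_succ _ (by positivity)
  rw [vmax, hwd]
  rw [Finset.mem_Icc] at hx
  unfold leafOf at hlt
  omega

/-- If the interval of `w` contains `x` and reaches up to `m > x`, then `w` is a proper ancestor
of the leaf of `m`. -/
lemma exists_leafOf_div_eq {h x w m : ℕ} (hx : x ∈ Finset.Icc 1 (2 ^ h)) (hw : 1 ≤ w)
    (ha : AncOrEq w (leafOf (2 ^ h) x)) (hxm : x < m) (hm : m ≤ vmax (2 ^ h) w) :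
    ∃ i ∈ Finset.Icc 1 h, leafOf (2 ^ h) m / 2 ^ i = w := by
  obtain ⟨i, hih, hi, hwd⟩ := exists_width_eq_s8 hx hw ha
  have hle : w * 2 ^ i ≤ leafOf (2 ^ h) x := by
    rw [← hi]
    exact Nat.div_mul_le_self _ _
  rw [vmax, hwd] at hm
  rw [Finset.mem_Icc] at hx
  refine ⟨i, Finset.mem_Icc.2 ⟨?_, hih⟩, ?_⟩
  · rw [Nat.one_le_iff_ne_zero]
    rintro rfl
    simp only [pow_zero, Nat.div_one, mul_one, leafOf] at hi hm
    omega
  · apply Nat.div_eq_of_lt_le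
    · unfold leafOf at hle ⊢; omega
    · unfold leafOf at hle ⊢; omega

lemma vmax_le {h v : ℕ} (hv : v ∈ nodes (2 ^ h)) : vmax (2 ^ h) v ≤ 2 ^ h := by
  rw [nodes, Finset.mem_Icc] at hv
  have hlt : v < 2 ^ (Nat.log 2 v + 1) := Nat.lt_pow_succ_log_self (by norm_num) v
  have hlog : Nat.log 2 v ≤ h := by
    have : Nat.log 2 v < h + 1 :=
      Nat.log_lt_of_lt_pow (by omega) (by rw [pow_succ]; omega)
    omega
  have hmul : (v + 1) * width (2 ^ h) v ≤ 2 ^ h + 2 ^ h :=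
    calc (v + 1) * width (2 ^ h) v ≤ 2 ^ (Nat.log 2 v + 1) * 2 ^ (h - Nat.log 2 v) := by
          rw [width, Nat.pow_div hlog (by norm_num)]
          exact Nat.mul_le_mul_right _ hlt
      _ = 2 ^ h + 2 ^ h := by
          rw [← pow_add, show Nat.log 2 v + 1 + (h - Nat.log 2 v) = h + 1 by omega, pow_succ]
          omega
  unfold vmax
  omega

/-- The counts on the path of inner nodes above the leaf of `m` add up to at most `h * b`, when
every inner node has count at most `b`. -/
lemma sum_count_inner_path_le {h m b : ℕ} {count : ℕ → ℕ} (hm : m ≤ 2 ^ h)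
    (hb : ∀ w < 2 ^ h, count w ≤ b) :
    ∑ w ∈ (Finset.Icc 1 h).image (fun i => leafOf (2 ^ h) m / 2 ^ i), count w ≤ h * b := by
  have hpos : 0 < 2 ^ h := by positivity
  have hbound : ∀ w ∈ (Finset.Icc 1 h).image (fun i => leafOf (2 ^ h) m / 2 ^ i),
      count w ≤ b := by
    intro w hw
    obtain ⟨i, hi, rfl⟩ := Finset.mem_image.1 hw
    apply hb
    have hi2 : 2 ≤ 2 ^ i := by
      simpa using Nat.pow_le_pow_right (n := 2) (by norm_num) (Finset.mem_Icc.1 hi).1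
    calc leafOf (2 ^ h) m / 2 ^ i ≤ leafOf (2 ^ h) m / 2 := Nat.div_le_div_left hi2 (by norm_num)
      _ < 2 ^ h := by unfold leafOf; omega
  have hcard : ((Finset.Icc 1 h).image (fun i => leafOf (2 ^ h) m / 2 ^ i)).card ≤ h := by
    simpa using Finset.card_image_le (s := Finset.Icc 1 h)
      (f := fun i => leafOf (2 ^ h) m / 2 ^ i)
  calc _ ≤ _ := Finset.sum_le_card_nsmul _ _ b hbound
    _ ≤ h * b := by
      rw [smul_eq_mul]
      exact Nat.mul_le_mul_right b hcard

end QDigest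

open QDigest

/-- let a q-digest (total count `n`, compression parameter `k`)
satisfy digest property (1) and summarize a multiset `S` of `n` values from
`[1, σ]`, and set `ε = log₂(σ)/k`. If `v` is the first node of the post-order
list `L` at which the running sum of the counts reaches at least `q·n` (i.e.
the prefix sum through `v` is `≥ q·n` while the prefix sum through the strict
predecessors of `v` is `< q·n`), then the reported value `v.max` has rank in
`S` between `q·n` and `(q+ε)·n`: at least `q·n` elements of `S` are `≤ v.max`,
and fewer than `(q+ε)·n + 1` elements of `S` are `< v.max`. -/
theorem quantile_query_bounds
    (h σ : ℕ) (hh : 1 ≤ h) (hσ : σ = 2 ^ h)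
    (count : ℕ → ℕ) (hsupp : ∀ v, count v ≠ 0 → v ∈ nodes σ)
    (S : Multiset ℕ) (hS : ∀ x ∈ S, x ∈ Finset.Icc 1 σ)
    (n k : ℕ) (hcard : Multiset.card S = n) (hn : total σ count = n) (hk : 1 ≤ k)
    (hsum : Summarizes σ count S)
    (hprop1 : ∀ v ∈ support σ count, v < σ → count v ≤ n / k)
    (q : ℝ) (hq0 : 0 < q) (hq1 : q < 1)
    (v : ℕ) (hv : v ∈ support σ count)
    (hreach : q * (n : ℝ)
      ≤ ((∑ w ∈ (support σ count).filter (fun w => postLE σ w v), count w : ℕ) : ℝ))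
    (hfirst : ((∑ w ∈ (support σ count).filter (fun w => postLE σ w v ∧ w ≠ v),
        count w : ℕ) : ℝ) < q * (n : ℝ)) :
    q * (n : ℝ) ≤ (Multiset.card (S.filter fun x => x ≤ vmax σ v) : ℝ) ∧
    (Multiset.card (S.filter fun x => x < vmax σ v) : ℝ)
      < (q + (Nat.log 2 σ : ℝ) / (k : ℝ)) * (n : ℝ) + 1 := by
  subst hσ
  obtain ⟨P, rfl, hP, hcount⟩ := hsum
  have hval : ∀ p ∈ P, p.1 ∈ Finset.Icc 1 (2 ^ h) :=
    fun p hp => hS p.1 (Multiset.mem_map_of_mem _ hp)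
  have hpos : ∀ p ∈ P, 1 ≤ p.2 := fun p hp => (Finset.mem_Icc.1 (hP p hp).1).1
  have hsupport : ∀ p ∈ P, p.2 ∈ support (2 ^ h) count := by
    intro p hp
    refine Finset.mem_filter.2 ⟨(hP p hp).1, ?_⟩
    rw [hcount]
    have hmem : p ∈ P.filter fun a => a.2 = p.2 := Multiset.mem_filter.2 ⟨hp, rfl⟩
    exact (Multiset.card_pos_iff_exists_mem.2 ⟨p, hmem⟩).ne'
  have hsumcard : ∀ A : Finset ℕ,
      ∑ w ∈ A, count w = Multiset.card (P.filter fun p => p.2 ∈ A) := by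
    intro A
    simp only [hcount, sum_card_filter_snd]
  rw [card_filter_map_fst, card_filter_map_fst]
  constructor
  · refine hreach.trans ?_
    rw [hsumcard]
    norm_cast
    refine card_filter_le_of_imp fun p hp hpA => ?_
    have hx := le_vmax (hval p hp) (hpos p hp) (hP p hp).2
    rcases (Finset.mem_filter.1 hpA).2 with hlt | ⟨heq, -⟩
    · exact hx.trans hlt.le
    · exact hx.trans heq.le
  · set B := (support (2 ^ h) count).filter (fun w => postLE (2 ^ h) w v ∧ w ≠ v)
    set m := vmax (2 ^ h) v
    set C := (Finset.Icc 1 h).image (fun i => leafOf (2 ^ h) m / 2 ^ i)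
    have hcover : Multiset.card (P.filter fun p => p.1 < m)
        ≤ Multiset.card (P.filter fun p => p.2 ∈ B ∪ C) := by
      refine card_filter_le_of_imp fun p hp hpm => ?_
      rw [Finset.mem_union]
      by_cases hm : m ≤ vmax (2 ^ h) p.2
      · right
        exact Finset.mem_image.2
          (exists_leafOf_div_eq (hval p hp) (hpos p hp) (hP p hp).2 hpm hm)
      · left
        rw [not_le] at hm
        refine Finset.mem_filter.2 ⟨hsupport p hp, Or.inl hm, ?_⟩
        intro heq
        rw [heq] at hm
        exact hm.false
    have hunion : ∑ w ∈ B ∪ C, count w ≤ ∑ w ∈ B, count w + ∑ w ∈ C, count w := by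
      rw [← Finset.sum_union_inter]
      exact Nat.le_add_right _ _
    have hC : ∑ w ∈ C, count w ≤ h * (n / k) := by
      apply sum_count_inner_path_le (vmax_le (Finset.mem_filter.1 hv).1)
      intro w hw
      by_cases h0 : count w = 0
      · simp [h0]
      · exact hprop1 w (Finset.mem_filter.2 ⟨hsupp w h0, h0⟩) hw
    rw [← hsumcard] at hcover
    have hnat : (Multiset.card (P.filter fun p => p.1 < m) : ℝ)
        ≤ ((∑ w ∈ B, count w : ℕ) : ℝ) + h * ((n / k : ℕ) : ℝ) := by
      exact_mod_cast hcover.trans (hunion.trans (Nat.add_le_add_left hC _))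
    have hdiv : (h : ℝ) * ((n / k : ℕ) : ℝ) ≤ h * ((n : ℝ) / k) :=
      mul_le_mul_of_nonneg_left Nat.cast_div_le (Nat.cast_nonneg h)
    rw [Nat.log_pow (by norm_num), add_mul, div_mul_eq_mul_div, mul_div_assoc]
    linarith
end

section
/- Let a q-digest with total count n and compression parameter k satisfy digest property (1) and summarize a multiset S of n values from [1,σ], and set ε = (log₂ σ)/k. Given s ∈ (0,1), the consensus query reports every value j ∈ [1,σ] whose unit-width leaf bucket has count(leaf_j) > (s−ε)n. Then: (completeness) every value whose multiplicity in S exceeds sn is reported; and (soundness) every reported value has multiplicity in S greater than (s−ε)n, so the only possible false positives are values with multiplicity between (s−ε)n and sn. -/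
open scoped Classical

open QDigest

namespace QDigest

/-- Union bound for the cardinality of filtered multisets. -/
theorem card_filter_le_sum_card_filter {α ι : Type*} (I : Finset ι) (p : α → Prop)
    [DecidablePred p] (q : ι → α → Prop) [∀ i, DecidablePred (q i)] (P : Multiset α)
    (hpq : ∀ a ∈ P, p a → ∃ i ∈ I, q i a) :
    Multiset.card (P.filter p) ≤ ∑ i ∈ I, Multiset.card (P.filter (q i)) := by
  simp only [← Multiset.countP_eq_card_filter]
  induction P using Multiset.induction_on with
  | empty => simp
  | cons a P ih =>
    have hP := ih fun b hb => hpq b (Multiset.mem_cons_of_mem hb)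
    simp only [Multiset.countP_cons, Finset.sum_add_distrib]
    refine Nat.add_le_add hP ?_
    split_ifs with ha
    · obtain ⟨i, hi, hqi⟩ := hpq a (Multiset.mem_cons_self a P) ha
      calc 1 = if q i a then 1 else 0 := by simp [hqi]
        _ ≤ _ := Finset.single_le_sum (f := fun i => if q i a then 1 else 0)
          (fun _ _ => Nat.zero_le _) hi
    · exact Nat.zero_le _

/-- A leaf has no proper descendants among the leaves. -/
theorem eq_of_ancOrEq_leafOf {σ j x : ℕ} (hj : 1 ≤ j) (hx : x ∈ Finset.Icc 1 σ)
    (hanc : AncOrEq (leafOf σ j) (leafOf σ x)) : x = j := by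
  obtain ⟨i, hi⟩ := hanc
  simp only [leafOf, Finset.mem_Icc] at *
  cases i with
  | zero => simp at hi; omega
  | succ i =>
    have hle : (σ - 1 + x) / 2 ^ (i + 1) ≤ (σ - 1 + x) / 2 :=
      Nat.div_le_div_left (by rw [pow_succ]; have := Nat.one_le_two_pow (n := i); omega)
        (by norm_num)
    omega

/-- The count of a leaf is at most the multiplicity of its value. -/
theorem Summarizes.count_leafOf_le {σ : ℕ} {count : ℕ → ℕ} {S : Multiset ℕ}
    (hsum : Summarizes σ count S) (hS : ∀ x ∈ S, x ∈ Finset.Icc 1 σ) {j : ℕ} (hj : 1 ≤ j) :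
    count (leafOf σ j) ≤ Multiset.count j S := by
  obtain ⟨P, rfl, hP, hcount⟩ := hsum
  rw [hcount, Multiset.count_map]
  refine Multiset.card_le_card (Multiset.le_filter.2 ⟨Multiset.filter_le _ _, fun p hp => ?_⟩)
  rw [Multiset.mem_filter] at hp
  exact (eq_of_ancOrEq_leafOf hj (hS _ (Multiset.mem_map_of_mem _ hp.1))
    (hp.2 ▸ (hP p hp.1).2)).symm

/-- The multiplicity of a value is at most the sum of the counts on the path from its leaf
to the root. -/
theorem Summarizes.multiplicity_le_sum {h : ℕ} {count : ℕ → ℕ} {S : Multiset ℕ}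
    (hsum : Summarizes (2 ^ h) count S) {j : ℕ} (hj : j ∈ Finset.Icc 1 (2 ^ h)) :
    Multiset.count j S ≤ ∑ i ∈ Finset.range (h + 1), count (leafOf (2 ^ h) j / 2 ^ i) := by
  obtain ⟨P, rfl, hP, hcount⟩ := hsum
  simp only [hcount, Multiset.count_map]
  refine card_filter_le_sum_card_filter _ (fun p : ℕ × ℕ => j = p.1)
    (fun i p => p.2 = leafOf (2 ^ h) j / 2 ^ i) P
    fun p hp hpj => ?_
  obtain ⟨hnode, i, hi⟩ := hP p hp
  refine ⟨i, ?_, by rw [hpj]; exact hi.symm⟩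
  by_contra hlt
  rw [Finset.mem_range, not_lt] at hlt
  have hpow : 2 ^ (h + 1) ≤ 2 ^ i := Nat.pow_le_pow_right (by norm_num) hlt
  rw [Finset.mem_Icc] at hj
  have hzero : leafOf (2 ^ h) p.1 / 2 ^ i = 0 := by
    apply Nat.div_eq_of_lt
    rw [pow_succ] at hpow
    simp only [leafOf]
    omega
  simp only [nodes, Finset.mem_Icc] at hnode
  omega

/-- If every internal node has count at most `m`, the multiplicity of a value exceeds the count of its leaf by
at most `h * m`. -/
theorem Summarizes.multiplicity_le {h : ℕ} {count : ℕ → ℕ} {S : Multiset ℕ} {m : ℕ}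
    (hsum : Summarizes (2 ^ h) count S) (hsupp : ∀ v, count v ≠ 0 → v ∈ nodes (2 ^ h))
    (hprop1 : ∀ v ∈ support (2 ^ h) count, v < 2 ^ h → count v ≤ m)
    {j : ℕ} (hj : j ∈ Finset.Icc 1 (2 ^ h)) :
    Multiset.count j S ≤ count (leafOf (2 ^ h) j) + h * m := by
  refine (hsum.multiplicity_le_sum hj).trans ?_
  rw [Finset.sum_range_succ', pow_zero, Nat.div_one, add_comm]
  refine Nat.add_le_add_left ?_ _
  calc _ ≤ ∑ _i ∈ Finset.range h, m := Finset.sum_le_sum fun i _ => ?_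
    _ = h * m := by simp
  by_cases hzero : count (leafOf (2 ^ h) j / 2 ^ (i + 1)) = 0
  · simp [hzero]
  · refine hprop1 _ (Finset.mem_filter.2 ⟨hsupp _ hzero, hzero⟩) ?_
    rw [Finset.mem_Icc] at hj
    refine Nat.div_lt_of_lt_mul ?_
    have hpow := Nat.one_le_two_pow (n := i)
    simp only [leafOf]
    calc 2 ^ h - 1 + j < 2 * 2 ^ h := by omega
      _ ≤ 2 ^ (i + 1) * 2 ^ h := Nat.mul_le_mul_right _ (by rw [pow_succ]; omega)

end QDigest

/-- let a q-digest (total count `n`, compression parameter `k`)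
satisfy digest property (1) and summarize a multiset `S` of `n` values from
`[1, σ]`, and set `ε = log₂(σ)/k`. The consensus query for `s ∈ (0,1)` reports
every value `j ∈ [1, σ]` whose unit-width leaf bucket satisfies
`count(leaf_j) > (s−ε)·n`. Then: (completeness) every value whose multiplicity
in `S` exceeds `s·n` is reported; and (soundness) every reported value has
multiplicity in `S` greater than `(s−ε)·n`. -/
theorem consensus_query_bounds
    (h σ : ℕ) (hh : 1 ≤ h) (hσ : σ = 2 ^ h)
    (count : ℕ → ℕ) (hsupp : ∀ v, count v ≠ 0 → v ∈ nodes σ)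
    (S : Multiset ℕ) (hS : ∀ x ∈ S, x ∈ Finset.Icc 1 σ)
    (n k : ℕ) (hcard : Multiset.card S = n) (hn : total σ count = n) (hk : 1 ≤ k)
    (hsum : Summarizes σ count S)
    (hprop1 : ∀ v ∈ support σ count, v < σ → count v ≤ n / k)
    (s : ℝ) (hs0 : 0 < s) (hs1 : s < 1) :
    (∀ j ∈ Finset.Icc 1 σ, s * (n : ℝ) < (Multiset.count j S : ℝ) →
      (s - (Nat.log 2 σ : ℝ) / (k : ℝ)) * (n : ℝ) < (count (leafOf σ j) : ℝ)) ∧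
    (∀ j ∈ Finset.Icc 1 σ,
      (s - (Nat.log 2 σ : ℝ) / (k : ℝ)) * (n : ℝ) < (count (leafOf σ j) : ℝ) →
      (s - (Nat.log 2 σ : ℝ) / (k : ℝ)) * (n : ℝ) < (Multiset.count j S : ℝ)) := by
  subst hσ
  refine ⟨fun j hj hlt => ?_, fun j hj hlt => hlt.trans_le ?_⟩
  · rw [Nat.log_pow (by norm_num)]
    have hle : (Multiset.count j S : ℝ) ≤ count (leafOf (2 ^ h) j) + h * ((n / k : ℕ) : ℝ) := by
      exact_mod_cast hsum.multiplicity_le hsupp hprop1 hj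
    have hdiv : (h : ℝ) * ((n / k : ℕ) : ℝ) ≤ h * ((n : ℝ) / k) :=
      mul_le_mul_of_nonneg_left Nat.cast_div_le (Nat.cast_nonneg h)
    have hexp : (s - (h : ℝ) / k) * n = s * n - h * ((n : ℝ) / k) := by ring
    linarith
  · exact_mod_cast hsum.count_leafOf_le hS (Finset.mem_Icc.1 hj).1
end

section
/- The median of a union of two datasets is not determined by the medians of the parts, and the uncertainty can be as large as n/2 in rank: for every odd n = 2t+1 ≥ 3 there exist multisets B, B′, C of n integers each, with B and B′ having the same median, such that the medians of the 2n-element multisets B ∪ C and B′ ∪ C differ, and the rank of the median of B ∪ C within B′ ∪ C differs from the median position n by at least (n−1)/2. -/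
/-- The median of a multiset `M` of `N` integers: the element of rank `⌈N/2⌉`
in the sorted order of `M` (so, for a multiset of `2n` elements, the element at
the median position `n`). -/
def medianM (M : Multiset ℤ) : ℤ :=
  (M.sort (· ≤ ·)).getD ((Multiset.card M + 1) / 2 - 1) 0

/-- The rank of a value `x` in a multiset `M`: the number of elements of `M`
that are less than `x`. -/
def rankM (M : Multiset ℤ) (x : ℤ) : ℕ :=
  Multiset.card (M.filter fun y => y < x)

/-- The median of a multiset given by a sorted list is read off from that list. -/
lemma medianM_coe_of_pairwise {l : List ℤ} (hl : l.Pairwise (· ≤ ·)) :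
    medianM (l : Multiset ℤ) = l.getD ((l.length + 1) / 2 - 1) 0 := by
  have hsort : (l : Multiset ℤ).sort (· ≤ ·) = l :=
    List.Perm.eq_of_pairwise' (Multiset.pairwise_sort _ _) hl
      (Multiset.coe_eq_coe.mp (Multiset.sort_eq _ _))
  rw [medianM, hsort, Multiset.coe_card]

/-- The median of a multiset of `a` zeros, `b` ones and `c` twos. -/
lemma medianM_replicate_zero_one_two (a b c : ℕ) :
    medianM (Multiset.replicate a 0 + Multiset.replicate b 1 + Multiset.replicate c 2) =
      (List.replicate a (0 : ℤ) ++ List.replicate b 1 ++ List.replicate c 2).getD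
        ((a + b + c + 1) / 2 - 1) 0 := by
  have h := medianM_coe_of_pairwise
    (l := List.replicate a (0 : ℤ) ++ List.replicate b 1 ++ List.replicate c 2) (by
      simp only [List.pairwise_append, List.pairwise_replicate, List.mem_append,
        List.mem_replicate]
      grind)
  simpa [← Multiset.coe_add, Multiset.coe_replicate, add_assoc] using h

/-- the median of a union of two datasets is not determined by
the medians of the parts, and the uncertainty can be as large as `n/2` in rank:
for every odd `n = 2t + 1 ≥ 3` there exist multisets `B, B′, C` of `n` integers
each, with `B` and `B′` having the same median, such that the medians of the
`2n`-element multisets `B ∪ C` and `B′ ∪ C` differ, and the rank of the median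
of `B ∪ C` within `B′ ∪ C` differs from the median position `n` by at least
`(n − 1)/2 = t`. -/
theorem median_not_in_network_computable (t : ℕ) (ht : 1 ≤ t) :
    ∃ B B' C : Multiset ℤ,
      Multiset.card B = 2 * t + 1 ∧
      Multiset.card B' = 2 * t + 1 ∧
      Multiset.card C = 2 * t + 1 ∧
      medianM B = medianM B' ∧
      medianM (B + C) ≠ medianM (B' + C) ∧
      (t : ℤ) ≤ |(rankM (B' + C) (medianM (B + C)) : ℤ) - (2 * (t : ℤ) + 1)| := by
  have hB : medianM (Multiset.replicate (2 * t + 1) 0) = 0 := by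
    have h := medianM_replicate_zero_one_two (2 * t + 1) 0 0
    simp only [Multiset.replicate_zero, add_zero] at h
    rw [h]
    grind
  have hB' : medianM (Multiset.replicate (t + 1) 0 + Multiset.replicate t 2) = 0 := by
    have h := medianM_replicate_zero_one_two (t + 1) 0 t
    simp only [Multiset.replicate_zero, add_zero] at h
    rw [h]
    grind
  have hBC : medianM (Multiset.replicate (2 * t + 1) 0 + Multiset.replicate (2 * t + 1) 1) = 0 := by
    have h := medianM_replicate_zero_one_two (2 * t + 1) (2 * t + 1) 0
    simp only [Multiset.replicate_zero, add_zero] at h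
    rw [h]
    grind
  have hB'C : medianM (Multiset.replicate (t + 1) 0 + Multiset.replicate t 2 +
      Multiset.replicate (2 * t + 1) 1) = 1 := by
    rw [add_right_comm, medianM_replicate_zero_one_two]
    grind
  have hrank : rankM (Multiset.replicate (t + 1) 0 + Multiset.replicate t 2 +
      Multiset.replicate (2 * t + 1) 1) 0 = 0 := by
    rw [rankM, Multiset.card_eq_zero, Multiset.filter_eq_nil]
    simp only [Multiset.mem_add, Multiset.mem_replicate]
    grind
  refine ⟨Multiset.replicate (2 * t + 1) 0, Multiset.replicate (t + 1) 0 + Multiset.replicate t 2,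
    Multiset.replicate (2 * t + 1) 1, by simp, by simp; omega, by simp, by rw [hB, hB'],
    by rw [hBC, hB'C]; decide, ?_⟩
  rw [hBC, hrank]
  grind
end
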